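/- Let A ⊆ ℕ be an infinite set and A_N the set of its N smallest elements. For every N ∈ ℕ and every s > 0, the variance over T² of the function F(s, N, A) : (α, γ) ↦ F(α, γ, s, N, A) satisfies σ²(F(s, N, A)) ≤ 2·E(A_N)·s/N³. -/

import Mathlib

open MeasureTheory Filter Set

noncomputable section

/-- The torus `𝕋 = ℝ/ℤ`, equipped with its Haar (Lebesgue) probability measure `volume`. -/
abbrev 𝕋 := UnitAddCircle

/-- The increasing enumeration (0-indexed) of a set `A ⊆ ℕ`; for infinite `A`,
`enum A 0 < enum A 1 < ⋯` lists the elements of `A` in increasing order. -/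
noncomputable def enum (A : Set ℕ) (n : ℕ) : ℕ := Nat.nth (· ∈ A) n

/-- `A_N`: the set of the `N` smallest elements of `A` (for `A` infinite). -/
noncomputable def firstN (A : Set ℕ) (N : ℕ) : Finset ℕ :=
  (Finset.range N).image (enum A)

/-- Additive energy `E(A) = #{(a,b,c,d) ∈ A⁴ : a + b = c + d}` of a finite set `A ⊆ ℕ`. -/
def addE (A : Finset ℕ) : ℕ :=
  (((A ×ˢ A) ×ˢ (A ×ˢ A)).filter (fun q => q.1.1 + q.1.2 = q.2.1 + q.2.2)).card

/-- The inhomogeneous pair correlation function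
`F(γ, s, N, x) = (1/N) · #{(i,j) ∈ [N]×[N] : i ≠ j, ‖x_i − x_j − γ‖ ≤ s/N}`
of a sequence `x` of points of `𝕋` (indices `0, …, N-1` playing the role of `[N]`). -/
noncomputable def Fseq (γ : 𝕋) (s : ℝ) (N : ℕ) (x : ℕ → 𝕋) : ℝ :=
  (Set.ncard {ij : ℕ × ℕ | ij.1 < N ∧ ij.2 < N ∧ ij.1 ≠ ij.2 ∧
      ‖x ij.1 - x ij.2 - γ‖ ≤ s / N} : ℝ) / N

/-- `F(α, γ, s, N, 𝒜)`: the pair correlation function of the points `a_n α ∈ 𝕋`,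
where `(a_n)` is the increasing enumeration of `A ⊆ ℕ`. -/
noncomputable def Fpc (α γ : 𝕋) (s : ℝ) (N : ℕ) (A : Set ℕ) : ℝ :=
  Fseq γ s N (fun n => (enum A n) • α)

/-- `A ⊆ ℕ` has doubly metric Poissonian pair correlations along the sequence `Nt`:
for Lebesgue-a.e. `(α, γ) ∈ 𝕋²` and every `s > 0`, `F(α, γ, s, N_t, 𝒜) → 2s`. -/
def DMPPCAlong (A : Set ℕ) (Nt : ℕ → ℕ) : Prop :=
  ∀ᵐ p : 𝕋 × 𝕋, ∀ s : ℝ, 0 < s →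
    Tendsto (fun t => Fpc p.1 p.2 s (Nt t) A) atTop (nhds (2 * s))

/-- `A ⊆ ℕ` has doubly metric Poissonian pair correlations. -/
def DMPPC (A : Set ℕ) : Prop := DMPPCAlong A id

instance : IsProbabilityMeasure (volume : Measure 𝕋) :=
  ⟨UnitAddCircle.measure_univ⟩

/-- For distinct integers `m, n` the endomorphism `(α, γ) ↦ (nα - γ, mα - γ)` of `𝕋²` preserves
Haar measure. -/
theorem measurePreserving_zsmul_sub_pair {m n : ℤ} (h : m ≠ n) :
    MeasurePreserving (fun p : 𝕋 × 𝕋 => (n • p.1 - p.2, m • p.1 - p.2))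
      (volume.prod volume) (volume.prod volume) := by
  have h₁ : MeasurePreserving (fun p : 𝕋 × 𝕋 => (p.1, m • p.1 - p.2))
      (volume.prod volume) (volume.prod volume) :=
    (MeasurePreserving.id volume).skew_product (g := fun a c : 𝕋 => m • a - c)
      (by unfold Function.uncurry; fun_prop)
      (.of_forall fun a => (volume.measurePreserving_sub_left (m • a)).map_eq)
  have h₂ : MeasurePreserving (fun p : 𝕋 × 𝕋 => (p.1, (n - m) • p.2 + p.1))
      (volume.prod volume) (volume.prod volume) :=
    (MeasurePreserving.id volume).skew_product (g := fun a c : 𝕋 => (n - m) • c + a)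
      (by unfold Function.uncurry; fun_prop)
      (.of_forall fun a => ((measurePreserving_add_right volume a).comp
        (Measure.measurePreserving_zsmul volume (sub_ne_zero.2 h.symm))).map_eq)
  have h₃ := Measure.measurePreserving_swap.comp
    (h₂.comp (Measure.measurePreserving_swap.comp h₁))
  convert h₃ using 1
  funext p
  simp only [Function.comp, Prod.swap, sub_smul]
  congr 1
  abel

/-- The map `(α, γ) ↦ mα - γ` from `𝕋²` to `𝕋` preserves Haar measure. -/
theorem measurePreserving_zsmul_sub (m : ℤ) :
    MeasurePreserving (fun p : 𝕋 × 𝕋 => m • p.1 - p.2) (volume.prod volume) volume :=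
  measurePreserving_snd.comp (measurePreserving_zsmul_sub_pair (m := m) (n := m + 1) (by simp))

theorem integral_comp_zsmul_sub (m : ℤ) {f : 𝕋 → ℝ} (hf : Measurable f) :
    ∫ p : 𝕋 × 𝕋, f (m • p.1 - p.2) = ∫ x, f x := by
  have h := measurePreserving_zsmul_sub m
  rw [← h.map_eq, integral_map h.measurable.aemeasurable hf.aestronglyMeasurable]
  rfl

theorem integral_comp_zsmul_sub_mul {m n : ℤ} (h : m ≠ n) {f : 𝕋 → ℝ} (hf : Measurable f) :
    ∫ p : 𝕋 × 𝕋, f (m • p.1 - p.2) * f (n • p.1 - p.2) = (∫ x, f x) ^ 2 := by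
  have hmp := measurePreserving_zsmul_sub_pair h.symm
  rw [sq, ← integral_prod_mul f f, ← hmp.map_eq, integral_map hmp.measurable.aemeasurable
    (Measurable.aestronglyMeasurable (by fun_prop))]
  rfl

/-- Second-moment identity for sums of pullbacks of an idempotent function: only coincidences
among the frequencies contribute to the variance. -/
theorem variance_sum_zsmul_sub {ι : Type*} (P : Finset ι) (d : ι → ℤ) {f : 𝕋 → ℝ}
    (hf : Measurable f) (hidem : ∀ x, f x * f x = f x) :
    (∫ p : 𝕋 × 𝕋, (∑ i ∈ P, f (d i • p.1 - p.2)) ^ 2) -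
        (∫ p : 𝕋 × 𝕋, ∑ i ∈ P, f (d i • p.1 - p.2)) ^ 2 =
      (((P ×ˢ P).filter fun q => d q.1 = d q.2).card : ℝ) * ((∫ x, f x) - (∫ x, f x) ^ 2) := by
  have hbound : ∀ x, ‖f x‖ ≤ 1 := fun x => by
    rcases IsIdempotentElem.iff_eq_zero_or_one.1 (hidem x) with h | h <;> simp [h]
  have hint : ∀ m : ℤ, Integrable (fun p : 𝕋 × 𝕋 => f (m • p.1 - p.2)) := fun m =>
    .of_bound (Measurable.aestronglyMeasurable (by fun_prop)) 1 (.of_forall fun p => hbound _)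
  have hint₂ : ∀ m n : ℤ,
      Integrable (fun p : 𝕋 × 𝕋 => f (m • p.1 - p.2) * f (n • p.1 - p.2)) := fun m n =>
    (hint n).bdd_mul (hint m).aestronglyMeasurable (.of_forall fun p => hbound _)
  have hmoment : ∀ m n : ℤ, ∫ p : 𝕋 × 𝕋, f (m • p.1 - p.2) * f (n • p.1 - p.2) =
      (if m = n then (∫ x, f x) - (∫ x, f x) ^ 2 else 0) + (∫ x, f x) ^ 2 := fun m n => by
    split_ifs with h
    · subst h
      simp only [hidem, integral_comp_zsmul_sub m hf, sub_add_cancel]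
    · rw [integral_comp_zsmul_sub_mul h hf, zero_add]
  have hsq : ∫ p : 𝕋 × 𝕋, (∑ i ∈ P, f (d i • p.1 - p.2)) ^ 2 =
      ∑ i ∈ P, ∑ j ∈ P, ∫ p : 𝕋 × 𝕋, f (d i • p.1 - p.2) * f (d j • p.1 - p.2) := by
    simp_rw [sq, Finset.sum_mul_sum]
    rw [integral_finsetSum _ fun i _ => integrable_finsetSum _ fun j _ => hint₂ _ _]
    exact Finset.sum_congr rfl fun i _ => integral_finsetSum _ fun j _ => hint₂ _ _
  rw [hsq, integral_finsetSum _ fun i _ => hint _]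
  simp_rw [hmoment, integral_comp_zsmul_sub _ hf]
  rw [← Finset.sum_product', Finset.sum_add_distrib, ← Finset.sum_filter]
  simp only [Finset.sum_const, Finset.card_product, nsmul_eq_mul, Nat.cast_mul]
  ring

theorem integral_indicator_closedBall_le {δ : ℝ} (hδ : 0 ≤ δ) :
    ∫ x : 𝕋, (Metric.closedBall (0 : 𝕋) δ).indicator 1 x ≤ 2 * δ := by
  rw [integral_indicator_one Metric.isClosed_closedBall.measurableSet, measureReal_def,
    AddCircle.volume_closedBall, ENNReal.toReal_ofReal (by positivity)]
  exact min_le_right _ _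

open Classical in
theorem Fpc_eq_sum (α γ : 𝕋) (s : ℝ) (N : ℕ) (A : Set ℕ) :
    Fpc α γ s N A = (∑ ij ∈ (Finset.range N).offDiag,
      (Metric.closedBall (0 : 𝕋) (s / N)).indicator (1 : 𝕋 → ℝ)
        (((enum A ij.1 : ℤ) - enum A ij.2) • α - γ)) / N := by
  have hset : {ij : ℕ × ℕ | ij.1 < N ∧ ij.2 < N ∧ ij.1 ≠ ij.2 ∧
      ‖enum A ij.1 • α - enum A ij.2 • α - γ‖ ≤ s / N} =
      ↑((Finset.range N).offDiag.filter fun ij =>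
        ((enum A ij.1 : ℤ) - enum A ij.2) • α - γ ∈ Metric.closedBall (0 : 𝕋) (s / N)) := by
    ext ij
    simp [sub_smul, and_assoc]
  rw [Fpc, Fseq, hset, Set.ncard_coe_finset, Finset.card_filter]
  push_cast
  simp only [Set.indicator_apply, Pi.one_apply]

/-- Coincidences among differences of distinct elements are counted by the additive energy. -/
theorem card_filter_sub_eq_le_addE {A : Set ℕ} (hA : A.Infinite) (N : ℕ) :
    (((Finset.range N).offDiag ×ˢ (Finset.range N).offDiag).filter fun q =>
      (enum A q.1.1 : ℤ) - enum A q.1.2 = (enum A q.2.1 : ℤ) - enum A q.2.2).card ≤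
      addE (firstN A N) := by
  have hinj : Function.Injective (enum A) := Nat.nth_injective hA
  refine Finset.card_le_card_of_injOn
    (fun q => ((enum A q.1.1, enum A q.2.2), (enum A q.2.1, enum A q.1.2))) ?_ ?_
  · rintro ⟨⟨a, b⟩, ⟨c, e⟩⟩ h
    simp only [Finset.coe_filter, Finset.mem_product, Finset.mem_offDiag, Finset.mem_range,
      Set.mem_ofPred_eq] at h
    obtain ⟨⟨⟨ha, hb, -⟩, hc, he, -⟩, heq⟩ := h
    have hmem : ∀ {i}, i < N → enum A i ∈ firstN A N := fun hi =>
      Finset.mem_image_of_mem _ (Finset.mem_range.2 hi)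
    simp only [Finset.coe_filter, Finset.mem_product, Set.mem_ofPred_eq]
    exact ⟨⟨⟨hmem ha, hmem he⟩, hmem hc, hmem hb⟩, by omega⟩
  · rintro ⟨⟨a, b⟩, ⟨c, e⟩⟩ - ⟨⟨a', b'⟩, ⟨c', e'⟩⟩ - h
    simp only [Prod.mk.injEq, hinj.eq_iff] at h
    obtain ⟨⟨rfl, rfl⟩, rfl, rfl⟩ := h
    rfl

/-- **Lemma (variance bound).** For any infinite `A ⊆ ℕ`, `N ∈ ℕ`, and `s > 0`, the variance of
`F(s, N, 𝒜)` over `𝕋²` satisfies `σ²(F(s, N, 𝒜)) ≤ 2·E(A_N)·s/N³`. -/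
theorem stmt_9 (A : Set ℕ) (hA : A.Infinite) (N : ℕ) (s : ℝ) (hs : 0 < s) :
    (∫ p : 𝕋 × 𝕋, (Fpc p.1 p.2 s N A) ^ 2) - (∫ p : 𝕋 × 𝕋, Fpc p.1 p.2 s N A) ^ 2 ≤
      2 * (addE (firstN A N) : ℝ) * s / (N : ℝ) ^ 3 := by
  set f : 𝕋 → ℝ := (Metric.closedBall (0 : 𝕋) (s / N)).indicator 1 with hf_def
  have hf : Measurable f :=
    measurable_one.indicator Metric.isClosed_closedBall.measurableSet
  have hidem : ∀ x, f x * f x = f x := fun x => by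
    by_cases hx : x ∈ Metric.closedBall (0 : 𝕋) (s / N) <;> simp [hf_def, hx]
  have hvar := variance_sum_zsmul_sub (Finset.range N).offDiag
    (fun ij => (enum A ij.1 : ℤ) - enum A ij.2) hf hidem
  have hcard : _ ≤ (addE (firstN A N) : ℝ) := Nat.cast_le.2 (card_filter_sub_eq_le_addE hA N)
  have hmean : ∫ x, f x ≤ 2 * (s / N) := integral_indicator_closedBall_le (by positivity)
  simp_rw [Fpc_eq_sum, div_pow, integral_div, ← hf_def]
  rw [div_pow, ← sub_div, hvar]
  calc _ ≤ (addE (firstN A N) : ℝ) * (2 * (s / N)) / (N : ℝ) ^ 2 := by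
        refine div_le_div_of_nonneg_right
          (mul_le_mul_of_nonneg hcard ?_ (Nat.cast_nonneg _) (by positivity)) (by positivity)
        linarith [sq_nonneg (∫ x, f x)]
    _ = _ := by
        rcases eq_or_ne (N : ℝ) 0 with h | h
        · simp [h]
        · field_simp
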